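/- Let 1 < p < ∞ and k₁, k₂ ∈ ℝ. There exists a constant C > 0 such that ‖𝓕f‖_{L^p_{k₂}} ≤ C ‖f‖_{L^p_{k₁}} for all f ∈ 𝓢(ℝ^d) if and only if either ( p ≤ 2 and k₁ ≥ 2d(1/p − 1/2) and k₂ ≤ 0 ) or ( p ≥ 2 and k₁ ≥ 0 and k₂ ≤ −2d(1/2 − 1/p) ). In other words, the Fourier transform is bounded from L^p_{k₁}(ℝ^d) to L^p_{k₂}(ℝ^d) exactly under these conditions. -/

import Mathlib

open MeasureTheory Real Filter
open scoped RealInnerProductSpace ENNReal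

noncomputable section

/-- The Fourier transform `𝓕f(ξ) = ∫ e^{-2πi ξ·x} f(x) dx`. -/
def FT {d : ℕ} (f : EuclideanSpace ℝ (Fin d) → ℂ) (ξ : EuclideanSpace ℝ (Fin d)) : ℂ :=
  ∫ (x : EuclideanSpace ℝ (Fin d)),
    Complex.exp (-(((2 * π * ⟪ξ, x⟫ : ℝ) : ℂ) * Complex.I)) * f x

/-- The inverse Fourier transform `𝓕⁻¹h(x) = ∫ e^{2πi x·ξ} h(ξ) dξ`. -/
def IFT {d : ℕ} (h : EuclideanSpace ℝ (Fin d) → ℂ) (x : EuclideanSpace ℝ (Fin d)) : ℂ :=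
  ∫ (ξ : EuclideanSpace ℝ (Fin d)),
    Complex.exp ((((2 * π * ⟪x, ξ⟫ : ℝ) : ℂ) * Complex.I)) * h ξ

/-- The Bessel potential Sobolev norm `‖f‖_{L^p_k} = ‖𝓕⁻¹(⟨·⟩^k 𝓕f)‖_{L^p}`,
where `⟨ξ⟩ = (1+|ξ|²)^{1/2}`. -/
def sobolevNorm {d : ℕ} (p k : ℝ) (f : EuclideanSpace ℝ (Fin d) → ℂ) : ℝ≥0∞ :=
  eLpNorm (IFT fun ξ => (((1 + ‖ξ‖ ^ 2) ^ (k / 2) : ℝ) : ℂ) * FT f ξ)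
    (ENNReal.ofReal p) volume

open scoped FourierTransform SchwartzMap

section

variable {E : Type*} [NormedAddCommGroup E] [InnerProductSpace ℝ E]

/-- Multiplication by `⟨x⟩ ^ a` on Schwartz functions, where `⟨x⟩ = (1 + ‖x‖ ^ 2) ^ (1 / 2)`. -/
def bracketMul (a : ℝ) : 𝓢(E, ℂ) →L[ℝ] 𝓢(E, ℂ) :=
  SchwartzMap.smulLeftCLM ℂ fun x : E => (1 + ‖x‖ ^ 2) ^ (a / 2)

theorem bracketMul_apply (a : ℝ) (f : 𝓢(E, ℂ)) (x : E) :
    bracketMul a f x = (((1 + ‖x‖ ^ 2) ^ (a / 2) : ℝ) : ℂ) * f x := by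
  rw [bracketMul, SchwartzMap.smulLeftCLM_apply_apply (by fun_prop), Complex.real_smul]

theorem bracketMul_neg_bracketMul (a : ℝ) (f : 𝓢(E, ℂ)) :
    bracketMul (-a) (bracketMul a f) = f := by
  ext x
  have : (0 : ℝ) < 1 + ‖x‖ ^ 2 := by positivity
  rw [bracketMul_apply, bracketMul_apply, ← mul_assoc, ← Complex.ofReal_mul,
    ← Real.rpow_add this]
  simp [neg_div]

/-- The dilation `f ↦ f (c • ·)` of Schwartz functions. -/
def dilate (c : ℝˣ) : 𝓢(E, ℂ) →L[ℂ] 𝓢(E, ℂ) :=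
  SchwartzMap.compCLMOfContinuousLinearEquiv ℂ (ContinuousLinearEquiv.smulLeft c)

theorem dilate_apply (c : ℝˣ) (f : 𝓢(E, ℂ)) (x : E) : dilate c f x = f ((c : ℝ) • x) := rfl

theorem dilate_dilate_inv (c : ℝˣ) (f : 𝓢(E, ℂ)) : dilate c (dilate c⁻¹ f) = f := by
  ext x
  rw [dilate_apply, dilate_apply, smul_smul, Units.inv_mul, one_smul]

variable [FiniteDimensional ℝ E] [MeasurableSpace E] [BorelSpace E]

theorem eLpNorm_fourierInv (f : 𝓢(E, ℂ)) (p : ℝ≥0∞) :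
    eLpNorm (𝓕⁻ f : 𝓢(E, ℂ)) p volume = eLpNorm (𝓕 f : 𝓢(E, ℂ)) p volume := by
  have h : ((𝓕⁻ f : 𝓢(E, ℂ)) : E → ℂ) = (𝓕 f : 𝓢(E, ℂ)) ∘ (fun x => -x) := by
    ext x
    rw [SchwartzMap.fourierInv_coe, Real.fourierInv_eq_fourier_neg, SchwartzMap.fourier_coe]
    rfl
  rw [h]
  exact eLpNorm_comp_measurePreserving (SchwartzMap.continuous _).aestronglyMeasurable
    (Measure.measurePreserving_neg volume)

/-- Plancherel's theorem on `L¹ ∩ L²`, for the Fourier transform given by the integral. -/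
theorem eLpNorm_two_fourier {f : E → ℂ} (h1 : Integrable f) (h2 : MemLp f 2) :
    eLpNorm (𝓕 f) 2 volume = eLpNorm f 2 volume := by
  have hcont : Continuous (𝓕 f) :=
    VectorFourier.fourierIntegral_continuous Real.continuous_fourierChar
      (by exact continuous_inner) h1
  set F : Lp ℂ 2 (volume : Measure E) := h2.toLp f with hF
  have key : ∀ᵐ x, (𝓕 f) x = (𝓕 F : Lp ℂ 2 (volume : Measure E)) x := by
    refine ae_eq_of_integral_contDiff_smul_eq hcont.locallyIntegrable
      ((Lp.memLp (𝓕 F)).locallyIntegrable (by norm_num)) fun g hg hgs => ?_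
    have hgc : HasCompactSupport (fun x => (g x : ℂ)) := hgs.comp_left (g := Complex.ofReal) rfl
    have hgd : ContDiff ℝ (⊤ : ℕ∞) (fun x => (g x : ℂ)) :=
      Complex.ofRealCLM.contDiff.comp hg
    set G : 𝓢(E, ℂ) := hgc.toSchwartzMap hgd with hG
    have hGx : ∀ x, G x = g x := fun x => rfl
    have e := congrArg (fun T : 𝓢'(E, ℂ) => T G)
      (MeasureTheory.Lp.fourier_toTemperedDistribution_eq F)
    rw [TemperedDistribution.fourier_apply, Lp.toTemperedDistribution_apply,
      Lp.toTemperedDistribution_apply] at e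
    have e2 : ∫ x, g x • (𝓕 f) x = ∫ x, (𝓕 G) x • f x := by
      have := VectorFourier.integral_fourierIntegral_smul_eq_flip (L := innerₗ E)
        Real.continuous_fourierChar (by exact continuous_inner) (G.integrable (μ := volume)) h1
      rw [flip_innerₗ] at this
      exact this.symm
    rw [e2]
    have e3 : ∫ x, (𝓕 G) x • F x = ∫ x, (𝓕 G) x • f x := by
      refine integral_congr_ae ?_
      filter_upwards [h2.coeFn_toLp] with x hx
      rw [hx]
    rw [← e3, e]
    rfl
  rw [eLpNorm_congr_ae key]
  have := Lp.norm_fourier_eq F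
  rw [Lp.norm_def, Lp.norm_def, ENNReal.toReal_eq_toReal_iff' (Lp.memLp _).2.ne (Lp.memLp _).2.ne]
    at this
  rw [this, hF, eLpNorm_congr_ae h2.coeFn_toLp]

open ProbabilityTheory in
theorem integral_exp_neg_mul_gammaMeasure {a s : ℝ} (ha : 0 < a) (hs : 0 ≤ s) :
    ∫ t, Real.exp (-(s * t)) ∂(gammaMeasure a 1) = (1 + s) ^ (-a) := by
  rw [gammaMeasure, integral_withDensity_eq_integral_toReal_smul
    (show Measurable (gammaPDF a 1) from (measurable_gammaPDFReal a 1).ennreal_ofReal)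
    (by simp [gammaPDF])]
  have h1 : ∀ t : ℝ, (gammaPDF a 1 t).toReal • Real.exp (-(s * t)) =
      (Set.Ici (0 : ℝ)).indicator
        (fun t => (Gamma a)⁻¹ * (t ^ (a - 1) * Real.exp (-((1 + s) * t)))) t := by
    intro t
    by_cases ht : 0 ≤ t
    · have hG := (Gamma_pos_of_pos ha).le
      rw [gammaPDF_of_nonneg ht, ENNReal.toReal_ofReal (by positivity),
        Set.indicator_of_mem (by simpa using ht), smul_eq_mul,
        show -((1 + s) * t) = -(1 * t) + -(s * t) by ring, Real.exp_add]
      simp only [one_rpow]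
      ring
    · rw [gammaPDF_of_neg (by linarith), Set.indicator_of_notMem (by simpa using ht)]
      simp
  simp_rw [h1]
  rw [integral_indicator measurableSet_Ici, integral_Ici_eq_integral_Ioi, integral_const_mul,
    integral_rpow_mul_exp_neg_mul_Ioi ha (by positivity), one_div,
    Real.inv_rpow (by positivity), ← Real.rpow_neg (by positivity)]
  field_simp [(Gamma_pos_of_pos ha).ne']

open ProbabilityTheory in
/-- For `b < 0`, the weight `⟨x⟩ ^ b` is the Fourier transform of a probability measure. -/
theorem exists_isProbabilityMeasure_bracket {b : ℝ} (hb : b < 0) :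
    ∃ ν : Measure E, IsProbabilityMeasure ν ∧ ∀ x : E,
      ∫ y, (Real.fourierChar (-⟪x, y⟫) : ℂ) ∂ν = (((1 + ‖x‖ ^ 2) ^ (b / 2) : ℝ) : ℂ) := by
  have hb2 : 0 < -(b / 2) := by linarith
  have := isProbabilityMeasure_gammaMeasure hb2 one_pos
  set P := (gammaMeasure (-(b / 2)) 1).prod (stdGaussian E)
  have hX : Measurable (fun ω : ℝ × E => (√(2 * ω.1) / (2 * π)) • ω.2) := by fun_prop
  refine ⟨P.map (fun ω => (√(2 * ω.1) / (2 * π)) • ω.2),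
    Measure.isProbabilityMeasure_map hX.aemeasurable, fun x => ?_⟩
  have hm : Continuous fun y : E => (Real.fourierChar (-⟪x, y⟫) : ℂ) := by
    fun_prop
  rw [integral_map hX.aemeasurable hm.aestronglyMeasurable, integral_prod]
  swap
  · refine Integrable.of_bound (C := 1) (hm.measurable.comp hX).aestronglyMeasurable ?_
    exact ae_of_all _ fun ω => (Circle.norm_coe _).le
  have h1 : ∀ t : ℝ, ∫ z, (Real.fourierChar (-⟪x, (√(2 * t) / (2 * π)) • z⟫) : ℂ)
      ∂(stdGaussian E) = Complex.exp (-‖(√(2 * t)) • x‖ ^ 2 / 2) := by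
    intro t
    have := charFun_stdGaussian (-(√(2 * t)) • x)
    rw [charFun_apply] at this
    rw [neg_smul, norm_neg] at this
    rw [← this]
    refine integral_congr_ae (ae_of_all _ fun z => ?_)
    simp only [Real.fourierChar_apply]
    congr 1
    rw [real_inner_smul_right, inner_neg_right, real_inner_smul_right, real_inner_comm]
    push_cast
    have : (π : ℂ) ≠ 0 := by exact_mod_cast Real.pi_ne_zero
    field_simp
  simp_rw [h1]
  have h2 : ∫ t, Complex.exp (-‖(√(2 * t)) • x‖ ^ 2 / 2) ∂(gammaMeasure (-(b / 2)) 1) =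
      ∫ t, ((Real.exp (-(‖x‖ ^ 2 * t)) : ℝ) : ℂ) ∂(gammaMeasure (-(b / 2)) 1) := by
    refine integral_congr_ae ?_
    have h0 : ∀ᵐ t ∂(gammaMeasure (-(b / 2)) 1), 0 ≤ t := by
      rw [ae_iff, gammaMeasure]
      simp only [not_le]
      change (volume.withDensity _) (Set.Iio (0 : ℝ)) = 0
      rw [withDensity_apply _ (measurableSet_Iio (a := (0 : ℝ)))]
      exact (setLIntegral_congr_fun measurableSet_Iio fun t ht => gammaPDF_of_neg ht).trans
        lintegral_zero
    filter_upwards [h0] with t ht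
    rw [norm_smul, ← Complex.ofReal_pow, mul_pow, Real.norm_eq_abs, sq_abs,
      Real.sq_sqrt (by positivity)]
    push_cast
    congr 1
    ring
  rw [h2, integral_complex_ofReal, integral_exp_neg_mul_gammaMeasure hb2 (by positivity), neg_neg]

/-- Averaging translates against a probability measure is a contraction of `L^q`. -/
theorem eLpNorm_integral_add_le (ν : Measure E) [IsProbabilityMeasure ν] {h : E → ℂ}
    (hh : Continuous h) {q : ℝ} (hq : 1 ≤ q) :
    eLpNorm (fun y => ∫ x, h (y + x) ∂ν) (ENNReal.ofReal q) volume ≤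
      eLpNorm h (ENNReal.ofReal q) volume := by
  have hq0 : 0 < q := by linarith
  have e0 : ENNReal.ofReal q ≠ 0 := by simpa using hq0
  rw [eLpNorm_eq_lintegral_rpow_enorm_toReal e0 ENNReal.ofReal_ne_top,
    eLpNorm_eq_lintegral_rpow_enorm_toReal e0 ENNReal.ofReal_ne_top, ENNReal.toReal_ofReal hq0.le]
  refine ENNReal.rpow_le_rpow ?_ (by positivity)
  have hc : Continuous fun z : E × E => h (z.1 + z.2) := by fun_prop
  calc ∫⁻ y, ‖∫ x, h (y + x) ∂ν‖ₑ ^ q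
      ≤ ∫⁻ y, ∫⁻ x, ‖h (y + x)‖ₑ ^ q ∂ν := by
        refine lintegral_mono fun y => ?_
        have hy : Continuous fun x => h (y + x) := by fun_prop
        calc ‖∫ x, h (y + x) ∂ν‖ₑ ^ q ≤ (∫⁻ x, ‖h (y + x)‖ₑ ∂ν) ^ q :=
              ENNReal.rpow_le_rpow (enorm_integral_le_lintegral_enorm _) hq0.le
          _ ≤ ((∫⁻ x, ‖h (y + x)‖ₑ ^ q ∂ν) ^ (1 / q)) ^ q := by
              refine ENNReal.rpow_le_rpow ?_ hq0.le
              have := eLpNorm_le_eLpNorm_of_exponent_le (μ := ν)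
                (show (1 : ℝ≥0∞) ≤ ENNReal.ofReal q by simpa using hq) hy.aestronglyMeasurable
              rwa [eLpNorm_one_eq_lintegral_enorm,
                eLpNorm_eq_lintegral_rpow_enorm_toReal e0 ENNReal.ofReal_ne_top,
                ENNReal.toReal_ofReal hq0.le] at this
          _ = ∫⁻ x, ‖h (y + x)‖ₑ ^ q ∂ν := by
              rw [← ENNReal.rpow_mul, one_div, inv_mul_cancel₀ hq0.ne', ENNReal.rpow_one]
    _ = ∫⁻ x, ∫⁻ y, ‖h (y + x)‖ₑ ^ q ∂volume ∂ν :=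
        lintegral_lintegral_swap (hc.enorm.measurable.pow_const q).aemeasurable
    _ = ∫⁻ _ : E, ∫⁻ y, ‖h y‖ₑ ^ q ∂volume ∂ν := by
        refine lintegral_congr fun x => ?_
        exact lintegral_add_right_eq_self (fun y => ‖h y‖ₑ ^ q) x
    _ = ∫⁻ y, ‖h y‖ₑ ^ q := by simp

/-- Bessel potentials of nonpositive order are contractions of `L^q`. -/
theorem eLpNorm_fourier_bracketMul_le {b q : ℝ} (hb : b ≤ 0) (hq : 1 ≤ q) (w : 𝓢(E, ℂ)) :
    eLpNorm (𝓕 (bracketMul b w) : 𝓢(E, ℂ)) (ENNReal.ofReal q) volume ≤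
      eLpNorm (𝓕 w : 𝓢(E, ℂ)) (ENNReal.ofReal q) volume := by
  rcases hb.eq_or_lt with rfl | hb
  · have : bracketMul 0 w = w := by
      ext x
      simp [bracketMul_apply]
    rw [this]
  obtain ⟨ν, hν, hx⟩ := exists_isProbabilityMeasure_bracket (E := E) hb
  have key : ((𝓕 (bracketMul b w) : 𝓢(E, ℂ)) : E → ℂ) =
      fun y => ∫ x, (𝓕 w : 𝓢(E, ℂ)) (y + x) ∂ν := by
    ext y
    rw [SchwartzMap.fourier_coe, SchwartzMap.fourier_coe, Real.fourier_eq]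
    simp_rw [Real.fourier_eq]
    rw [integral_integral_swap]
    · refine integral_congr_ae (ae_of_all _ fun v => ?_)
      simp only [bracketMul_apply, ← hx, Circle.smul_def, smul_eq_mul]
      rw [← mul_assoc, ← integral_const_mul, ← integral_mul_const]
      refine integral_congr_ae (ae_of_all _ fun x => ?_)
      simp only [inner_add_right, neg_add, AddChar.map_add_eq_mul, Circle.coe_mul]
    · have h1 : Integrable (fun z : E × E => w z.2) (ν.prod volume) :=
        (w.integrable (μ := volume)).comp_snd ν
      have hc : Continuous fun z : E × E =>
          (Real.fourierChar (-⟪z.2, y + z.1⟫)) • w z.2 := by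
        have := w.continuous
        fun_prop
      exact h1.mono hc.aestronglyMeasurable (ae_of_all _ fun z => by simp [Function.uncurry])
  rw [key]
  exact eLpNorm_integral_add_le ν (SchwartzMap.continuous _) hq

theorem lintegral_rpow_Ioo_zero {r : ℝ} (hr : -1 < r) {s : ℝ} (hs : 0 ≤ s) :
    ∫⁻ t in Set.Ioo 0 s, ENNReal.ofReal (t ^ r) = ENNReal.ofReal (s ^ (r + 1) / (r + 1)) := by
  have hi : IntegrableOn (fun t : ℝ => t ^ r) (Set.Ioo 0 s) :=
    ((intervalIntegrable_iff_integrableOn_Ioc_of_le hs).1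
      (intervalIntegral.intervalIntegrable_rpow' hr)).mono_set Set.Ioo_subset_Ioc_self
  rw [← ofReal_integral_eq_lintegral_ofReal hi
    ((ae_restrict_iff' measurableSet_Ioo).2 (ae_of_all _ fun t ht => Real.rpow_nonneg ht.1.le _)),
    ← integral_Ioc_eq_integral_Ioo, ← intervalIntegral.integral_of_le hs,
    integral_rpow (Or.inl hr), Real.zero_rpow (by linarith), sub_zero]

theorem lintegral_rpow_Ici {r : ℝ} (hr : r < -1) {s : ℝ} (hs : 0 < s) :
    ∫⁻ t in Set.Ici s, ENNReal.ofReal (t ^ r) = ENNReal.ofReal (s ^ (r + 1) / -(r + 1)) := by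
  rw [setLIntegral_congr Ioi_ae_eq_Ici.symm, ← ofReal_integral_eq_lintegral_ofReal
    (integrableOn_Ioi_rpow_of_lt hr hs)
    ((ae_restrict_iff' measurableSet_Ioi).2
      (ae_of_all _ fun t ht => Real.rpow_nonneg (hs.trans ht).le _)),
    integral_Ioi_rpow_of_lt hr hs, div_neg, neg_div]

/-- Averaging the `L¹` norms of the upper truncations of `g` produces the `L^p` norm. -/
theorem lintegral_upper_truncation {α : Type*} [MeasurableSpace α] (μ : Measure α) [SFinite μ]
    {g : α → ℝ} (hg : Measurable g) (hg0 : ∀ x, 0 ≤ g x) {p : ℝ} (hp : 1 < p) :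
    ∫⁻ t in Set.Ioi 0, ENNReal.ofReal (t ^ (p - 2)) *
        ∫⁻ x, {x | t < g x}.indicator (fun x => ENNReal.ofReal (g x)) x ∂μ =
      ENNReal.ofReal (1 / (p - 1)) * ∫⁻ x, ENNReal.ofReal (g x ^ p) ∂μ := by
  have hS : MeasurableSet {z : ℝ × α | z.1 < g z.2} :=
    measurableSet_lt measurable_fst (hg.comp measurable_snd)
  have hm : Measurable fun z : ℝ × α => ENNReal.ofReal (z.1 ^ (p - 2)) *
      {z : ℝ × α | z.1 < g z.2}.indicator (fun z => ENNReal.ofReal (g z.2)) z := by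
    refine Measurable.mul (by fun_prop) (Measurable.indicator (by fun_prop) hS)
  calc _ = ∫⁻ t in Set.Ioi 0, ∫⁻ x, ENNReal.ofReal (t ^ (p - 2)) *
        {x | t < g x}.indicator (fun x => ENNReal.ofReal (g x)) x ∂μ := by
        refine lintegral_congr fun t => ?_
        rw [lintegral_const_mul]
        exact Measurable.indicator (by fun_prop) (measurableSet_lt measurable_const hg)
    _ = ∫⁻ x, ∫⁻ t : ℝ in Set.Ioi 0, ENNReal.ofReal (t ^ (p - 2)) *
        {x | t < g x}.indicator (fun x => ENNReal.ofReal (g x)) x ∂volume ∂μ :=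
        lintegral_lintegral_swap hm.aemeasurable
    _ = ∫⁻ x, ENNReal.ofReal (1 / (p - 1)) * ENNReal.ofReal (g x ^ p) ∂μ := by
        refine lintegral_congr fun x => ?_
        have : ∀ t : ℝ, ENNReal.ofReal (t ^ (p - 2)) *
            {x | t < g x}.indicator (fun x => ENNReal.ofReal (g x)) x =
            (Set.Iio (g x)).indicator
              (fun t => ENNReal.ofReal (g x) * ENNReal.ofReal (t ^ (p - 2))) t := by
          intro t
          by_cases h : t < g x
          · simp [Set.indicator, h, mul_comm]
          · simp [Set.indicator, h]
        simp_rw [this]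
        rw [lintegral_indicator measurableSet_Iio, Measure.restrict_restrict measurableSet_Iio,
          Set.inter_comm, Set.Ioi_inter_Iio, lintegral_const_mul _ (by fun_prop),
          lintegral_rpow_Ioo_zero (by linarith) (hg0 x), ← ENNReal.ofReal_mul (hg0 x),
          ← ENNReal.ofReal_mul (by simp; linarith)]
        congr 1
        rcases (hg0 x).eq_or_lt with h0 | h0
        · rw [← h0, Real.zero_rpow (by linarith : p ≠ 0)]
          simp
        · rw [show g x ^ p = g x ^ (p - 2 + 1) * g x by
            rw [← Real.rpow_add_one h0.ne']; ring_nf]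
          ring_nf
    _ = _ := lintegral_const_mul _ (by fun_prop)

/-- Averaging the squared `L²` norms of the lower truncations of `g` produces the `L^p` norm. -/
theorem lintegral_lower_truncation {α : Type*} [MeasurableSpace α] (μ : Measure α) [SFinite μ]
    {g : α → ℝ} (hg : Measurable g) (hg0 : ∀ x, 0 ≤ g x) {p : ℝ} (hp : 1 < p) (hp2 : p < 2) :
    ∫⁻ t in Set.Ioi 0, ENNReal.ofReal (t ^ (p - 3)) *
        ∫⁻ x, {x | g x ≤ t}.indicator (fun x => ENNReal.ofReal (g x ^ 2)) x ∂μ =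
      ENNReal.ofReal (1 / (2 - p)) * ∫⁻ x, ENNReal.ofReal (g x ^ p) ∂μ := by
  have hS : MeasurableSet {z : ℝ × α | g z.2 ≤ z.1} :=
    measurableSet_le (hg.comp measurable_snd) measurable_fst
  have hm : Measurable fun z : ℝ × α => ENNReal.ofReal (z.1 ^ (p - 3)) *
      {z : ℝ × α | g z.2 ≤ z.1}.indicator (fun z => ENNReal.ofReal (g z.2 ^ 2)) z := by
    refine Measurable.mul (by fun_prop) (Measurable.indicator (by fun_prop) hS)
  calc _ = ∫⁻ t in Set.Ioi 0, ∫⁻ x, ENNReal.ofReal (t ^ (p - 3)) *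
        {x | g x ≤ t}.indicator (fun x => ENNReal.ofReal (g x ^ 2)) x ∂μ := by
        refine lintegral_congr fun t => ?_
        rw [lintegral_const_mul]
        exact Measurable.indicator (by fun_prop) (measurableSet_le hg measurable_const)
    _ = ∫⁻ x, ∫⁻ t : ℝ in Set.Ioi 0, ENNReal.ofReal (t ^ (p - 3)) *
        {x | g x ≤ t}.indicator (fun x => ENNReal.ofReal (g x ^ 2)) x ∂volume ∂μ :=
        lintegral_lintegral_swap hm.aemeasurable
    _ = ∫⁻ x, ENNReal.ofReal (1 / (2 - p)) * ENNReal.ofReal (g x ^ p) ∂μ := by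
        refine lintegral_congr fun x => ?_
        have : ∀ t : ℝ, ENNReal.ofReal (t ^ (p - 3)) *
            {x | g x ≤ t}.indicator (fun x => ENNReal.ofReal (g x ^ 2)) x =
            (Set.Ici (g x)).indicator
              (fun t => ENNReal.ofReal (g x ^ 2) * ENNReal.ofReal (t ^ (p - 3))) t := by
          intro t
          by_cases h : g x ≤ t
          · simp [Set.indicator, h, mul_comm]
          · simp [Set.indicator, h]
        simp_rw [this]
        rcases (hg0 x).eq_or_lt with h0 | h0
        · rw [← h0, Real.zero_rpow (by linarith)]
          simp
        · rw [lintegral_indicator measurableSet_Ici, Measure.restrict_restrict measurableSet_Ici,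
            Set.inter_eq_left.2 (show Set.Ici (g x) ⊆ Set.Ioi 0 from fun t ht => h0.trans_le ht),
            lintegral_const_mul _ (by fun_prop),
            lintegral_rpow_Ici (by linarith) h0, ← ENNReal.ofReal_mul (by positivity),
            ← ENNReal.ofReal_mul (by simp; linarith)]
          congr 1
          rw [show g x ^ p = g x ^ (p - 3 + 1) * g x ^ 2 by
            rw [← Real.rpow_add_natCast h0.ne']; push_cast; ring_nf]
          ring_nf
    _ = _ := lintegral_const_mul _ (by fun_prop)

/-- The tail of `⟨ξ⟩ ^ (-2 * d)` over `{⟨ξ⟩ ^ d > R}` is `O(1 / R)`. -/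
theorem exists_lintegral_bracket_tail_le (hd : 0 < Module.finrank ℝ E) :
    ∃ K : ℝ, 0 ≤ K ∧ ∀ R : ℝ, 0 < R →
      ∫⁻ ξ : E in {ξ | R < (1 + ‖ξ‖ ^ 2) ^ ((Module.finrank ℝ E : ℝ) / 2)},
        ENNReal.ofReal ((1 + ‖ξ‖ ^ 2) ^ (-(Module.finrank ℝ E : ℝ))) ≤ ENNReal.ofReal (K / R) := by
  set d : ℝ := (Module.finrank ℝ E : ℝ) with hd_def
  have hd0 : 0 < d := by simpa [hd_def] using hd
  have hI : Integrable (fun x : E => ((1 : ℝ) + ‖x‖ ^ 2) ^ (-d)) := by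
    have := integrable_rpow_neg_one_add_norm_sq (E := E) (μ := volume)
      (show (Module.finrank ℝ E : ℝ) < 2 * d by rw [← hd_def]; linarith)
    simpa [neg_div, mul_div_assoc, mul_comm, neg_mul] using this
  refine ⟨2 ^ d * ∫ x : E, ((1 : ℝ) + ‖x‖ ^ 2) ^ (-d), by positivity, fun R hR => ?_⟩
  have hS : MeasurableSet {ξ : E | R < (1 + ‖ξ‖ ^ 2) ^ (d / 2)} :=
    measurableSet_lt measurable_const (by fun_prop)
  rw [← ofReal_integral_eq_lintegral_ofReal hI.integrableOn
    (ae_of_all _ fun x => by positivity), ← integral_indicator hS]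
  refine ENNReal.ofReal_le_ofReal ?_
  set g : E → ℝ := {ξ : E | R < (1 + ‖ξ‖ ^ 2) ^ (d / 2)}.indicator
    fun x => ((1 : ℝ) + ‖x‖ ^ 2) ^ (-d) with hg
  have hgi : Integrable g := hI.indicator hS
  set ρ : ℝ := R ^ (1 / d) with hρ
  have hρ0 : 0 < ρ := by positivity
  have hρd : ρ ^ Module.finrank ℝ E = R := by
    rw [← Real.rpow_natCast, ← hd_def, hρ, ← Real.rpow_mul hR.le]
    simp [hd0.ne']
  have hscale := Measure.integral_comp_smul (volume : Measure E) g ρ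
  rw [hρd, abs_of_pos (by positivity), smul_eq_mul] at hscale
  have hpt : ∀ x : E, g (ρ • x) ≤ 2 ^ d * R ^ (-2 : ℝ) * (1 + ‖x‖ ^ 2) ^ (-d) := by
    intro x
    have hx : (0 : ℝ) < 1 + ‖x‖ ^ 2 := by positivity
    by_cases h : R < (1 + ‖ρ • x‖ ^ 2) ^ (d / 2)
    · rw [hg, Set.indicator_of_mem (by exact h)]
      rw [norm_smul, Real.norm_eq_abs, abs_of_pos hρ0, mul_pow] at h ⊢
      have h1 : ρ ^ 2 < 1 + ρ ^ 2 * ‖x‖ ^ 2 := by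
        have : R ^ (2 / d) < ((1 + ρ ^ 2 * ‖x‖ ^ 2) ^ (d / 2)) ^ (2 / d) :=
          Real.rpow_lt_rpow hR.le h (by positivity)
        rw [← Real.rpow_mul (by positivity), show d / 2 * (2 / d) = 1 by field_simp,
          Real.rpow_one] at this
        have e : ρ ^ 2 = R ^ (2 / d) := by
          rw [hρ, ← Real.rpow_natCast, ← Real.rpow_mul hR.le,
            show 1 / d * ((2 : ℕ) : ℝ) = 2 / d by push_cast; ring]
        rwa [← e] at this
      have h2 : ρ ^ 2 * (1 + ‖x‖ ^ 2) / 2 ≤ 1 + ρ ^ 2 * ‖x‖ ^ 2 := by nlinarith [sq_nonneg ‖x‖]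
      calc (1 + ρ ^ 2 * ‖x‖ ^ 2) ^ (-d) ≤ (ρ ^ 2 * (1 + ‖x‖ ^ 2) / 2) ^ (-d) :=
            Real.rpow_le_rpow_of_nonpos (by positivity) h2 (by linarith)
        _ = 2 ^ d * R ^ (-2 : ℝ) * (1 + ‖x‖ ^ 2) ^ (-d) := by
            rw [Real.div_rpow (by positivity) (by positivity),
              Real.mul_rpow (by positivity) (by positivity), ← Real.rpow_natCast ρ 2,
              ← Real.rpow_mul hρ0.le, hρ, ← Real.rpow_mul hR.le,
              show 1 / d * (((2 : ℕ) : ℝ) * -d) = -2 by field_simp; norm_num,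
              Real.rpow_neg (by positivity) d]
            field_simp
            rw [Real.rpow_neg (by positivity : (0 : ℝ) ≤ 2)]
            field_simp
    · rw [hg, Set.indicator_of_notMem (by exact h)]
      positivity
  have hle : ∫ x, g (ρ • x) ≤ ∫ x : E, 2 ^ d * R ^ (-2 : ℝ) * (1 + ‖x‖ ^ 2) ^ (-d) :=
    integral_mono (hgi.comp_smul hρ0.ne') (hI.const_mul _) hpt
  rw [hscale, integral_const_mul, inv_mul_le_iff₀ hR] at hle
  refine hle.trans_eq ?_
  rw [Real.rpow_neg hR.le, Real.rpow_two]
  field_simp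

variable (E) in
/-- The measure `⟨ξ⟩ ^ (-2 * d) dξ`, where `d = dim E`. -/
def bracketMeasure : Measure E :=
  volume.withDensity fun ξ => ENNReal.ofReal ((1 + ‖ξ‖ ^ 2) ^ (-(Module.finrank ℝ E : ℝ)))

theorem exists_bracketMeasure_lt_fourier_le (hd : 0 < Module.finrank ℝ E) :
    ∃ K : ℝ, 0 ≤ K ∧ ∀ (u : E → ℂ), Integrable u → ∀ t : ℝ, 0 < t →
      bracketMeasure E {ξ | t < (1 + ‖ξ‖ ^ 2) ^ ((Module.finrank ℝ E : ℝ) / 2) * ‖𝓕 u ξ‖} ≤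
        ENNReal.ofReal (K / t) * ∫⁻ x, ‖u x‖ₑ := by
  obtain ⟨K, hK, h⟩ := exists_lintegral_bracket_tail_le hd
  refine ⟨K, hK, fun u hu t ht => ?_⟩
  set N : ℝ := ∫ x, ‖u x‖ with hN
  have hN0 : 0 ≤ N := by positivity
  have hle : ∀ ξ, ‖𝓕 u ξ‖ ≤ N := fun ξ =>
    VectorFourier.norm_fourierIntegral_le_integral_norm _ _ _ _ _
  rcases hN0.eq_or_lt with h0 | h0
  · refine le_of_eq_of_le (measure_mono_null (fun ξ hξ => ?_) measure_empty) (by positivity)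
    have : ‖𝓕 u ξ‖ = 0 := le_antisymm (h0 ▸ hle ξ) (norm_nonneg _)
    simp only [Set.mem_ofPred_eq, this, mul_zero] at hξ
    linarith
  · calc _ ≤ bracketMeasure E {ξ | t / N < (1 + ‖ξ‖ ^ 2) ^ ((Module.finrank ℝ E : ℝ) / 2)} := by
          refine measure_mono fun ξ hξ => ?_
          rw [Set.mem_ofPred_eq, div_lt_iff₀ h0]
          exact hξ.trans_le (mul_le_mul_of_nonneg_left (hle ξ) (by positivity))
      _ ≤ ENNReal.ofReal (K / (t / N)) := by
          rw [bracketMeasure, withDensity_apply _ (measurableSet_lt measurable_const (by fun_prop))]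
          exact h _ (by positivity)
      _ = _ := by
          rw [← ofReal_integral_norm_eq_lintegral_enorm hu, ← hN,
            ← ENNReal.ofReal_mul (by positivity)]
          congr 1
          field_simp

theorem bracketMeasure_lt_fourier_le {u : E → ℂ} (hu : Integrable u) (hu2 : MemLp u 2) {t : ℝ}
    (ht : 0 < t) :
    bracketMeasure E {ξ | t < (1 + ‖ξ‖ ^ 2) ^ ((Module.finrank ℝ E : ℝ) / 2) * ‖𝓕 u ξ‖} ≤
      ENNReal.ofReal (1 / t ^ 2) * ∫⁻ x, ‖u x‖ₑ ^ 2 := by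
  have hcont : Continuous (𝓕 u) :=
    VectorFourier.fourierIntegral_continuous Real.continuous_fourierChar
      (by exact continuous_inner) hu
  have hw : Measurable fun ξ : E =>
      ENNReal.ofReal (((1 + ‖ξ‖ ^ 2) ^ ((Module.finrank ℝ E : ℝ) / 2) * ‖𝓕 u ξ‖) ^ 2) := by
    have := hcont.measurable
    fun_prop
  have hP := congrArg (fun z => z ^ ((2 : NNReal) : ℝ)) (eLpNorm_two_fourier hu hu2)
  have h2 : (2 : ℝ≥0∞) = ((2 : NNReal) : ℝ≥0∞) := rfl
  simp only [h2] at hP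
  rw [eLpNorm_nnreal_pow_eq_lintegral (by norm_num),
    eLpNorm_nnreal_pow_eq_lintegral (by norm_num)] at hP
  simp only [NNReal.coe_ofNat, ENNReal.rpow_ofNat] at hP
  rw [← hP]
  have hI : ∫⁻ ξ, ENNReal.ofReal (((1 + ‖ξ‖ ^ 2) ^ ((Module.finrank ℝ E : ℝ) / 2) * ‖𝓕 u ξ‖) ^ 2)
      ∂bracketMeasure E = ∫⁻ ξ, ‖𝓕 u ξ‖ₑ ^ 2 := by
    rw [bracketMeasure, lintegral_withDensity_eq_lintegral_mul _ (by fun_prop) hw]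
    refine lintegral_congr fun ξ => ?_
    have hpos : (0 : ℝ) < 1 + ‖ξ‖ ^ 2 := by positivity
    rw [Pi.mul_apply, ← ENNReal.ofReal_mul (by positivity), ← ofReal_norm,
      ← ENNReal.ofReal_pow (norm_nonneg _)]
    congr 1
    rw [mul_pow, ← Real.rpow_mul_natCast hpos.le, ← mul_assoc, ← Real.rpow_add hpos]
    simp
  have hM := mul_meas_ge_le_lintegral (μ := bracketMeasure E) hw (ENNReal.ofReal (t ^ 2))
  rw [hI] at hM
  have hsub : {ξ : E | t < (1 + ‖ξ‖ ^ 2) ^ ((Module.finrank ℝ E : ℝ) / 2) * ‖𝓕 u ξ‖} ⊆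
      {ξ | ENNReal.ofReal (t ^ 2) ≤
        ENNReal.ofReal (((1 + ‖ξ‖ ^ 2) ^ ((Module.finrank ℝ E : ℝ) / 2) * ‖𝓕 u ξ‖) ^ 2)} :=
    fun ξ hξ => ENNReal.ofReal_le_ofReal (pow_le_pow_left₀ ht.le (le_of_lt hξ) 2)
  calc _ ≤ _ := measure_mono hsub
    _ = ENNReal.ofReal (1 / t ^ 2) * (ENNReal.ofReal (t ^ 2) * _) := by
        rw [← mul_assoc, ← ENNReal.ofReal_mul (by positivity),
          one_div_mul_cancel (by positivity), ENNReal.ofReal_one, one_mul]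
    _ ≤ _ := by gcongr

/-- The interpolation step of Paley's inequality: truncating `u` at height `t`. -/
theorem exists_bracketMeasure_lt_fourier_le_truncation (hd : 0 < Module.finrank ℝ E) :
    ∃ K : ℝ, 0 ≤ K ∧ ∀ (u : 𝓢(E, ℂ)) (t : ℝ), 0 < t →
      bracketMeasure E
        {ξ | t < (1 + ‖ξ‖ ^ 2) ^ ((Module.finrank ℝ E : ℝ) / 2) * ‖𝓕 (u : E → ℂ) ξ‖} ≤
        (ENNReal.ofReal (K / t) *
          ∫⁻ x, {x | t < ‖u x‖}.indicator (fun x => ENNReal.ofReal ‖u x‖) x) +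
        ENNReal.ofReal (4 / t ^ 2) *
          ∫⁻ x, {x | ‖u x‖ ≤ t}.indicator (fun x => ENNReal.ofReal (‖u x‖ ^ 2)) x := by
  obtain ⟨K, hK, h⟩ := exists_bracketMeasure_lt_fourier_le hd
  refine ⟨2 * K, by positivity, fun u t ht => ?_⟩
  have hS : MeasurableSet {x | t < ‖u x‖} := measurableSet_lt measurable_const (by fun_prop)
  have hS' : MeasurableSet {x | ‖u x‖ ≤ t} := measurableSet_le (by fun_prop) measurable_const
  have hc : {x | ‖u x‖ ≤ t} = {x | t < ‖u x‖}ᶜ := by ext; simp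
  have hui : Integrable u := u.integrable
  set u1 : E → ℂ := {x | t < ‖u x‖}.indicator u with hu1
  set u2 : E → ℂ := {x | ‖u x‖ ≤ t}.indicator u with hu2
  have hi1 : Integrable u1 := hui.indicator hS
  have hi2 : Integrable u2 := hui.indicator hS'
  have hm2 : MemLp u2 2 := (u.memLp 2 volume).indicator hS'
  have hadd : (u : E → ℂ) = u1 + u2 := by
    rw [hu1, hu2, hc, Set.indicator_self_add_compl]
  have hF : ∀ ξ, 𝓕 (u : E → ℂ) ξ = 𝓕 u1 ξ + 𝓕 u2 ξ := fun ξ => by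
    have := VectorFourier.fourierIntegral_add (L := innerₗ E) Real.continuous_fourierChar
      (by exact continuous_inner) hi1 hi2
    rw [hadd]
    exact congrFun this ξ
  have ht2 : 0 < t / 2 := by positivity
  have e1 : ∫⁻ x, ‖u1 x‖ₑ = ∫⁻ x, {x | t < ‖u x‖}.indicator (fun x => ENNReal.ofReal ‖u x‖) x := by
    refine lintegral_congr fun x => ?_
    rw [hu1, enorm_indicator_eq_indicator_enorm]
    simp only [ofReal_norm]
  have e2 : ∫⁻ x, ‖u2 x‖ₑ ^ 2 =
      ∫⁻ x, {x | ‖u x‖ ≤ t}.indicator (fun x => ENNReal.ofReal (‖u x‖ ^ 2)) x := by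
    refine lintegral_congr fun x => ?_
    rw [hu2, enorm_indicator_eq_indicator_enorm]
    by_cases hx : x ∈ {x | ‖u x‖ ≤ t}
    · rw [Set.indicator_of_mem hx, Set.indicator_of_mem hx, ENNReal.ofReal_pow (norm_nonneg _),
        ofReal_norm]
    · rw [Set.indicator_of_notMem hx, Set.indicator_of_notMem hx]
      simp
  calc _ ≤ bracketMeasure E (
        {ξ | t / 2 < (1 + ‖ξ‖ ^ 2) ^ ((Module.finrank ℝ E : ℝ) / 2) * ‖𝓕 u1 ξ‖} ∪
        {ξ | t / 2 < (1 + ‖ξ‖ ^ 2) ^ ((Module.finrank ℝ E : ℝ) / 2) * ‖𝓕 u2 ξ‖}) := by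
        refine measure_mono fun ξ hξ => ?_
        simp only [Set.mem_ofPred_eq, Set.mem_union] at hξ ⊢
        by_contra! hcon
        have hn := norm_add_le (𝓕 u1 ξ) (𝓕 u2 ξ)
        rw [← hF] at hn
        have := mul_le_mul_of_nonneg_left hn
          (by positivity : 0 ≤ (1 + ‖ξ‖ ^ 2) ^ ((Module.finrank ℝ E : ℝ) / 2))
        linarith
    _ ≤ (ENNReal.ofReal (K / (t / 2)) * ∫⁻ x, ‖u1 x‖ₑ) +
        ENNReal.ofReal (1 / (t / 2) ^ 2) * ∫⁻ x, ‖u2 x‖ₑ ^ 2 :=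
        (measure_union_le _ _).trans
          (add_le_add (h u1 hi1 _ ht2) (bracketMeasure_lt_fourier_le hi2 hm2 ht2))
    _ = _ := by
        rw [e1, e2]
        congr 3
        · field_simp
        · field_simp; norm_num

/-- **Paley's inequality**. -/
theorem exists_lintegral_bracket_fourier_rpow_le (hd : 0 < Module.finrank ℝ E) {p : ℝ} (hp : 1 < p)
    (hp2 : p < 2) :
    ∃ K : ℝ, 0 ≤ K ∧ ∀ u : 𝓢(E, ℂ),
      ∫⁻ ξ, ENNReal.ofReal
        (((1 + ‖ξ‖ ^ 2) ^ ((Module.finrank ℝ E : ℝ) / 2) * ‖𝓕 (u : E → ℂ) ξ‖) ^ p)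
          ∂bracketMeasure E ≤
        ENNReal.ofReal K * ∫⁻ x, ENNReal.ofReal (‖u x‖ ^ p) := by
  obtain ⟨K, hK, h⟩ := exists_bracketMeasure_lt_fourier_le_truncation hd
  have hp1 : 0 < p - 1 := by linarith
  have hp2' : 0 < 2 - p := by linarith
  have hp0 : 0 < p := by linarith
  refine ⟨p * (K * (1 / (p - 1)) + 4 * (1 / (2 - p))), by positivity, fun u => ?_⟩
  have hcont : Continuous (𝓕 (u : E → ℂ)) := by
    rw [← SchwartzMap.fourier_coe]; exact SchwartzMap.continuous _
  have hmeas := hcont.measurable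
  have hug : Measurable fun x => ‖u x‖ := by fun_prop
  rw [lintegral_rpow_eq_lintegral_meas_lt_mul _ (ae_of_all _ fun ξ => by positivity)
    (by fun_prop) hp0]
  set A : ℝ → ℝ≥0∞ := fun t =>
    ∫⁻ x, {x | t < ‖u x‖}.indicator (fun x => ENNReal.ofReal ‖u x‖) x with hA
  set B : ℝ → ℝ≥0∞ := fun t =>
    ∫⁻ x, {x | ‖u x‖ ≤ t}.indicator (fun x => ENNReal.ofReal (‖u x‖ ^ 2)) x with hB
  have hAm : Measurable A := by
    refine Antitone.measurable fun s t hst => lintegral_mono fun x => ?_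
    exact Set.indicator_le_indicator_of_subset (fun x hx => lt_of_le_of_lt hst hx) (by simp) x
  have hstep : ∫⁻ t in Set.Ioi 0, bracketMeasure E
      {ξ | t < (1 + ‖ξ‖ ^ 2) ^ ((Module.finrank ℝ E : ℝ) / 2) * ‖𝓕 (u : E → ℂ) ξ‖} *
        ENNReal.ofReal (t ^ (p - 1)) ≤
      ∫⁻ t in Set.Ioi 0, (ENNReal.ofReal K * (ENNReal.ofReal (t ^ (p - 2)) * A t) +
        ENNReal.ofReal 4 * (ENNReal.ofReal (t ^ (p - 3)) * B t)) := by
    refine setLIntegral_mono' measurableSet_Ioi fun t ht => ?_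
    have ht : 0 < t := ht
    refine (mul_le_mul_left (h u t ht) _).trans_eq ?_
    rw [add_mul]
    simp only [← mul_assoc]
    rw [← ENNReal.ofReal_mul hK, ← ENNReal.ofReal_mul (by norm_num : (0 : ℝ) ≤ 4), mul_right_comm,
      mul_right_comm _ _ (ENNReal.ofReal (t ^ (p - 1))), ← ENNReal.ofReal_mul (by positivity),
      ← ENNReal.ofReal_mul (by positivity)]
    congr 3
    · rw [show p - 1 = p - 2 + 1 by ring, Real.rpow_add_one ht.ne']
      field_simp
    · rw [show p - 1 = p - 3 + (2 : ℕ) by push_cast; ring, Real.rpow_add_natCast ht.ne']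
      field_simp
  calc _ ≤ _ := mul_le_mul_right hstep _
    _ = _ := by
      rw [lintegral_add_left (by fun_prop), lintegral_const_mul' _ _ ENNReal.ofReal_ne_top,
        lintegral_const_mul' _ _ ENNReal.ofReal_ne_top,
        lintegral_upper_truncation volume hug (fun x => norm_nonneg _) hp,
        lintegral_lower_truncation volume hug (fun x => norm_nonneg _) hp hp2, ← mul_assoc,
        ← mul_assoc, ← add_mul, ← mul_assoc, ← ENNReal.ofReal_mul hK,
        ← ENNReal.ofReal_mul (by norm_num), ← ENNReal.ofReal_add (by positivity) (by positivity),
        ← ENNReal.ofReal_mul hp0.le]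

theorem exists_eLpNorm_bracketMul_fourier_le (hd : 0 < Module.finrank ℝ E) {p a : ℝ} (hp : 1 < p)
    (hp2 : p ≤ 2) (ha : a ≤ -(Module.finrank ℝ E * (2 / p - 1))) :
    ∃ K : ℝ, 0 ≤ K ∧ ∀ u : 𝓢(E, ℂ), eLpNorm (bracketMul a (𝓕 u)) (ENNReal.ofReal p) volume ≤
      ENNReal.ofReal K * eLpNorm u (ENNReal.ofReal p) volume := by
  have hp0 : 0 < p := by linarith
  rcases hp2.eq_or_lt with rfl | hp2
  · refine ⟨1, zero_le_one, fun u => ?_⟩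
    rw [ENNReal.ofReal_one, one_mul, show ENNReal.ofReal 2 = 2 by simp,
      ← eLpNorm_two_fourier u.integrable (u.memLp 2 volume), ← SchwartzMap.fourier_coe]
    refine eLpNorm_mono fun ξ => ?_
    have : (1 + ‖ξ‖ ^ 2) ^ (a / 2) ≤ 1 :=
      Real.rpow_le_one_of_one_le_of_nonpos (by nlinarith [sq_nonneg ‖ξ‖])
        (by norm_num at ha; linarith)
    rw [bracketMul_apply, norm_mul, Complex.norm_real, Real.norm_of_nonneg (by positivity)]
    exact mul_le_of_le_one_left (norm_nonneg _) this
  · obtain ⟨K, hK, h⟩ := exists_lintegral_bracket_fourier_rpow_le hd hp hp2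
    refine ⟨K ^ (1 / p), by positivity, fun u => ?_⟩
    have hpne : ENNReal.ofReal p ≠ 0 := by simpa using hp0
    have hmeas : Measurable (𝓕 (u : E → ℂ)) := by
      rw [← SchwartzMap.fourier_coe]; exact (SchwartzMap.continuous _).measurable
    rw [eLpNorm_eq_lintegral_rpow_enorm_toReal hpne ENNReal.ofReal_ne_top,
      eLpNorm_eq_lintegral_rpow_enorm_toReal hpne ENNReal.ofReal_ne_top,
      ENNReal.toReal_ofReal hp0.le, ← ENNReal.ofReal_rpow_of_nonneg hK (by positivity),
      ← ENNReal.mul_rpow_of_nonneg _ _ (by positivity)]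
    refine ENNReal.rpow_le_rpow ?_ (by positivity)
    have e : ∀ x, ‖u x‖ₑ ^ p = ENNReal.ofReal (‖u x‖ ^ p) := fun x => by
      rw [← ofReal_norm, ENNReal.ofReal_rpow_of_nonneg (norm_nonneg _) hp0.le]
    simp only [e]
    refine le_trans ?_ (h u)
    rw [bracketMeasure, lintegral_withDensity_eq_lintegral_mul _ (by fun_prop) (by fun_prop)]
    refine lintegral_mono fun ξ => ?_
    have hpos : (0 : ℝ) < 1 + ‖ξ‖ ^ 2 := by positivity
    rw [Pi.mul_apply, ← ENNReal.ofReal_mul (by positivity), ← ofReal_norm,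
      ENNReal.ofReal_rpow_of_nonneg (norm_nonneg _) hp0.le, bracketMul_apply, norm_mul,
      Complex.norm_real, Real.norm_of_nonneg (by positivity),
      Real.mul_rpow (by positivity) (norm_nonneg _), Real.mul_rpow (by positivity) (norm_nonneg _),
      ← Real.rpow_mul hpos.le, ← Real.rpow_mul hpos.le, ← mul_assoc, ← Real.rpow_add hpos,
      SchwartzMap.fourier_coe]
    refine ENNReal.ofReal_le_ofReal (mul_le_mul_of_nonneg_right
      (Real.rpow_le_rpow_of_exponent_le (by nlinarith [sq_nonneg ‖ξ‖]) ?_) (by positivity))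
    have := mul_le_mul_of_nonneg_right ha hp0.le
    have e : (Module.finrank ℝ E : ℝ) * (2 / p - 1) * p = Module.finrank ℝ E * (2 - p) := by
      field_simp
    nlinarith

theorem enorm_integral_mul_le {α : Type*} [MeasurableSpace α] {μ : Measure α} {f g : α → ℂ}
    {p q : ℝ} (hpq : p.HolderConjugate q) (hf : AEStronglyMeasurable f μ)
    (hg : AEStronglyMeasurable g μ) :
    ‖∫ x, f x * g x ∂μ‖ₑ ≤ eLpNorm f (ENNReal.ofReal p) μ * eLpNorm g (ENNReal.ofReal q) μ := by
  have hp := hpq.pos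
  have hq := hpq.symm.pos
  rw [eLpNorm_eq_lintegral_rpow_enorm_toReal (by simpa) ENNReal.ofReal_ne_top,
    eLpNorm_eq_lintegral_rpow_enorm_toReal (by simpa) ENNReal.ofReal_ne_top,
    ENNReal.toReal_ofReal hp.le, ENNReal.toReal_ofReal hq.le]
  refine (enorm_integral_le_lintegral_enorm _).trans ?_
  simp only [enorm_mul]
  exact ENNReal.lintegral_mul_le_Lp_mul_Lq μ hpq hf.enorm hg.enorm

/-- Duality characterisation of the `L^p` norm, testing against Schwartz functions. -/
theorem eLpNorm_le_of_forall_enorm_integral_mul_le {p q : ℝ} (hpq : p.HolderConjugate q)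
    (h : 𝓢(E, ℂ)) {A : ℝ≥0∞} (hA : A ≠ ⊤)
    (H : ∀ φ : 𝓢(E, ℂ), ‖∫ x, h x * φ x‖ₑ ≤ A * eLpNorm φ (ENNReal.ofReal q) volume) :
    eLpNorm h (ENNReal.ofReal p) volume ≤ A := by
  have hp := hpq.pos
  have hq := hpq.symm.pos
  have hp1 := hpq.lt
  set φ₀ : E → ℂ := fun x => ((‖h x‖ ^ (p - 2) : ℝ) : ℂ) * (starRingEnd ℂ) (h x) with hφ₀
  have hmeas : Measurable φ₀ := by fun_prop
  have hnorm : ∀ x, ‖φ₀ x‖ = ‖h x‖ ^ (p - 1) := fun x => by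
    rw [hφ₀]
    simp only [norm_mul, Complex.norm_real, RCLike.norm_conj]
    rw [Real.norm_of_nonneg (by positivity)]
    rcases (norm_nonneg (h x)).eq_or_lt with h0 | h0
    · rw [← h0, Real.zero_rpow (by linarith : p - 1 ≠ 0), mul_zero]
    · rw [← Real.rpow_add_one h0.ne']
      ring_nf
  set I : ℝ≥0∞ := ∫⁻ x, ‖h x‖ₑ ^ p with hI
  have hnorm_h : eLpNorm h (ENNReal.ofReal p) volume = I ^ (1 / p) := by
    rw [eLpNorm_eq_lintegral_rpow_enorm_toReal (by simpa) ENNReal.ofReal_ne_top,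
      ENNReal.toReal_ofReal hp.le]
  have hItop : I ≠ ⊤ := by
    have := (h.memLp (ENNReal.ofReal p) volume).2.ne
    rw [hnorm_h] at this
    intro hcon
    rw [hcon, ENNReal.top_rpow_of_pos (by positivity)] at this
    exact this rfl
  have hpow : ∀ x, ‖φ₀ x‖ₑ ^ q = ‖h x‖ₑ ^ p := fun x => by
    rw [← ofReal_norm, ← ofReal_norm, ENNReal.ofReal_rpow_of_nonneg (norm_nonneg _) hq.le,
      ENNReal.ofReal_rpow_of_nonneg (norm_nonneg _) hp.le, hnorm, ← Real.rpow_mul (norm_nonneg _),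
      hpq.sub_one_mul_conj]
  have hnorm_φ : eLpNorm φ₀ (ENNReal.ofReal q) volume = I ^ (1 / q) := by
    rw [eLpNorm_eq_lintegral_rpow_enorm_toReal (by simpa) ENNReal.ofReal_ne_top,
      ENNReal.toReal_ofReal hq.le]
    simp only [hpow, hI]
  have hφL : MemLp φ₀ (ENNReal.ofReal q) volume :=
    ⟨hmeas.aestronglyMeasurable, by
      rw [hnorm_φ]; exact ENNReal.rpow_lt_top_of_nonneg (by positivity) hItop⟩
  have hpt : ∀ x, h x * φ₀ x = ((‖h x‖ ^ p : ℝ) : ℂ) := fun x => by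
    rw [hφ₀]
    simp only
    rw [mul_left_comm, Complex.mul_conj, Complex.normSq_eq_norm_sq, ← Complex.ofReal_mul]
    congr 1
    rcases (norm_nonneg (h x)).eq_or_lt with h0 | h0
    · rw [← h0, Real.zero_rpow hp.ne']; simp
    · rw [← Real.rpow_add_natCast h0.ne']; push_cast; ring_nf
  have hint : ‖∫ x, h x * φ₀ x‖ₑ = I := by
    simp only [hpt]
    rw [integral_complex_ofReal, ← ofReal_norm, Complex.norm_real,
      Real.norm_of_nonneg (by positivity), integral_eq_lintegral_of_nonneg_ae
        (ae_of_all _ fun x => by positivity)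
        (Measurable.aestronglyMeasurable (by fun_prop)), ENNReal.ofReal_toReal]
    · refine lintegral_congr fun x => ?_
      rw [← ENNReal.ofReal_rpow_of_nonneg (norm_nonneg _) hp.le, ofReal_norm]
    · convert hItop using 1
      refine lintegral_congr fun x => ?_
      rw [← ENNReal.ofReal_rpow_of_nonneg (norm_nonneg _) hp.le, ofReal_norm]
  have hq1 : 1 ≤ ENNReal.ofReal q := by
    rw [← ENNReal.ofReal_one]; exact ENNReal.ofReal_le_ofReal hpq.symm.lt.le
  have hhp : ENNReal.HolderConjugate (ENNReal.ofReal p) (ENNReal.ofReal q) := hpq.ennrealOfReal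
  have happrox : ∀ ε : ℝ, 0 < ε → I ≤ A * I ^ (1 / q) + (A + I ^ (1 / p)) * ENNReal.ofReal ε := by
    intro ε hε
    obtain ⟨g, hgc, hgd, hg⟩ := hφL.exist_eLpNorm_sub_le ENNReal.ofReal_ne_top hq1 hε
    set G : 𝓢(E, ℂ) := hgc.toSchwartzMap hgd with hG
    have hGg : (G : E → ℂ) = g := rfl
    have hGL : MemLp g (ENNReal.ofReal q) volume := G.memLp _ _
    have hhL := h.memLp (ENNReal.ofReal p) volume
    have e : ∫ x, h x * φ₀ x = (∫ x, h x * (φ₀ - g) x) + ∫ x, h x * G x := by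
      rw [← integral_add (f := fun x => h x * (φ₀ - g) x) (g := fun x => h x * G x)
        (hhL.integrable_mul (hφL.sub hGL)) (hhL.integrable_mul (G.memLp (ENNReal.ofReal q) _))]
      simp only [hGg, Pi.sub_apply, ← mul_add, sub_add_cancel]
    have hg' : eLpNorm g (ENNReal.ofReal q) volume ≤ I ^ (1 / q) + ENNReal.ofReal ε := by
      have : g = φ₀ - (φ₀ - g) := by simp
      rw [this, ← hnorm_φ]
      exact (eLpNorm_sub_le hφL.1 (hφL.sub hGL).1 hq1).trans (by gcongr)
    calc I = ‖∫ x, h x * φ₀ x‖ₑ := hint.symm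
      _ ≤ ‖∫ x, h x * (φ₀ - g) x‖ₑ + ‖∫ x, h x * G x‖ₑ := by rw [e]; exact enorm_add_le _ _
      _ ≤ I ^ (1 / p) * ENNReal.ofReal ε + A * (I ^ (1 / q) + ENNReal.ofReal ε) := by
        gcongr
        · refine (enorm_integral_mul_le hpq hhL.1 (hφL.sub hGL).1).trans ?_
          rw [hnorm_h]
          gcongr
        · exact (H G).trans (mul_le_mul_right hg' _)
      _ = _ := by ring
  have hlim : Tendsto (fun ε : ℝ => A * I ^ (1 / q) + (A + I ^ (1 / p)) * ENNReal.ofReal ε)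
      (nhdsWithin 0 (Set.Ioi 0))
      (nhds (A * I ^ (1 / q) + (A + I ^ (1 / p)) * ENNReal.ofReal 0)) := by
    refine Tendsto.const_add _ (ENNReal.Tendsto.const_mul ?_ (Or.inr ?_))
    · exact (ENNReal.continuous_ofReal.tendsto 0).mono_left nhdsWithin_le_nhds
    · exact ENNReal.add_ne_top.2 ⟨hA, (ENNReal.rpow_lt_top_of_nonneg (by positivity) hItop).ne⟩
  have hfin : I ≤ A * I ^ (1 / q) := by
    have := ge_of_tendsto hlim (eventually_mem_nhdsWithin.mono fun ε hε => happrox ε hε)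
    simpa using this
  rw [hnorm_h]
  rcases eq_or_ne I 0 with h0 | h0
  · rw [h0, ENNReal.zero_rpow_of_pos (by positivity)]
    positivity
  · have hsum : 1 / p + 1 / q = 1 := by simpa using hpq.inv_add_inv_eq_one
    have hne : I ^ (1 / q) ≠ 0 := by
      simp [ENNReal.rpow_eq_zero_iff, h0, hItop]
    have hnt : I ^ (1 / q) ≠ ⊤ := (ENNReal.rpow_lt_top_of_nonneg (by positivity) hItop).ne
    rw [← ENNReal.mul_le_mul_iff_left hne hnt, ← ENNReal.rpow_add _ _ h0 hItop, hsum,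
      ENNReal.rpow_one]
    exact hfin

variable (E) in
/-- Boundedness of the bilinear form `(v, w) ↦ ∫ ⟨ξ⟩ ^ a v 𝓕(⟨·⟩ ^ b w)` with respect to the
norms `‖𝓕 v‖_p` and `‖𝓕 w‖_q`. -/
def FourierBilinearBound (p q a b : ℝ) : Prop :=
  ∃ K : ℝ, 0 ≤ K ∧ ∀ v w : 𝓢(E, ℂ), ‖∫ ξ, bracketMul a v ξ * (𝓕 (bracketMul b w) : 𝓢(E, ℂ)) ξ‖ₑ ≤
    ENNReal.ofReal K * eLpNorm (𝓕 v : 𝓢(E, ℂ)) (ENNReal.ofReal p) volume *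
      eLpNorm (𝓕 w : 𝓢(E, ℂ)) (ENNReal.ofReal q) volume

theorem FourierBilinearBound.symm {p q a b : ℝ} (h : FourierBilinearBound E p q a b) :
    FourierBilinearBound E q p b a := by
  obtain ⟨K, hK, h⟩ := h
  refine ⟨K, hK, fun v w => ?_⟩
  rw [← SchwartzMap.integral_fourier_mul_eq, mul_right_comm]
  simpa only [mul_comm] using h w v

theorem fourierBilinearBound_of_le_two (hd : 0 < Module.finrank ℝ E) {p q a b : ℝ}
    (hpq : p.HolderConjugate q) (hp2 : p ≤ 2) (ha : a ≤ -(Module.finrank ℝ E * (2 / p - 1)))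
    (hb : b ≤ 0) : FourierBilinearBound E p q a b := by
  obtain ⟨K, hK, h⟩ := exists_eLpNorm_bracketMul_fourier_le hd hpq.lt hp2 ha
  refine ⟨K, hK, fun v w => (enorm_integral_mul_le hpq
    (SchwartzMap.continuous _).aestronglyMeasurable
    (SchwartzMap.continuous _).aestronglyMeasurable).trans ?_⟩
  refine mul_le_mul' ?_ (eLpNorm_fourier_bracketMul_le hb hpq.symm.lt.le w)
  have := h (𝓕⁻ v)
  rwa [FourierTransform.fourier_fourierInv_eq, eLpNorm_fourierInv] at this

theorem integral_bracketMul_mul (a : ℝ) (f g : 𝓢(E, ℂ)) :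
    ∫ x, bracketMul a f x * g x = ∫ x, f x * bracketMul a g x := by
  refine integral_congr_ae (ae_of_all _ fun x => ?_)
  simp only [bracketMul_apply]
  ring

theorem integral_bracketMul_mul_fourier_bracketMul (a b : ℝ) (v w : 𝓢(E, ℂ)) :
    ∫ ξ, bracketMul a v ξ * (𝓕 (bracketMul b w) : 𝓢(E, ℂ)) ξ =
      ∫ x, (𝓕⁻ (bracketMul b (𝓕 (bracketMul a v))) : 𝓢(E, ℂ)) x * (𝓕 w : 𝓢(E, ℂ)) x := by
  rw [← SchwartzMap.integral_fourier_mul_eq, SchwartzMap.integral_fourierInv_mul_eq,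
    FourierTransform.fourierInv_fourier_eq, integral_bracketMul_mul]

/-- The Fourier transform is bounded from `L^p_{k₁}` to `L^p_{k₂}` if and only if the bilinear
form with exponents `-k₁` and `k₂` is bounded. -/
theorem fourierBilinearBound_iff {p q a b : ℝ} (hpq : p.HolderConjugate q) :
    FourierBilinearBound E p q (-a) b ↔ ∃ K : ℝ, 0 ≤ K ∧ ∀ f : 𝓢(E, ℂ),
      eLpNorm (𝓕⁻ (bracketMul b (𝓕 (𝓕 f))) : 𝓢(E, ℂ)) (ENNReal.ofReal p) volume ≤
        ENNReal.ofReal K *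
          eLpNorm (𝓕⁻ (bracketMul a (𝓕 f)) : 𝓢(E, ℂ)) (ENNReal.ofReal p) volume := by
  constructor
  · rintro ⟨K, hK, h⟩
    refine ⟨K, hK, fun f => eLpNorm_le_of_forall_enorm_integral_mul_le hpq _
      (ENNReal.mul_ne_top ENNReal.ofReal_ne_top (SchwartzMap.memLp _ _ _).2.ne) fun φ => ?_⟩
    have := h (bracketMul a (𝓕 f)) (𝓕⁻ φ)
    rwa [integral_bracketMul_mul_fourier_bracketMul, bracketMul_neg_bracketMul,
      FourierTransform.fourier_fourierInv_eq, ← eLpNorm_fourierInv] at this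
  · rintro ⟨K, hK, h⟩
    refine ⟨K, hK, fun v w => ?_⟩
    rw [integral_bracketMul_mul_fourier_bracketMul]
    refine (enorm_integral_mul_le hpq (SchwartzMap.continuous _).aestronglyMeasurable
      (SchwartzMap.continuous _).aestronglyMeasurable).trans ?_
    have := h (𝓕⁻ (bracketMul (-a) v))
    rw [FourierTransform.fourier_fourierInv_eq] at this
    have e : bracketMul a (bracketMul (-a) v) = v := by
      simpa using bracketMul_neg_bracketMul (-a) v
    rw [e, eLpNorm_fourierInv v] at this
    gcongr

theorem nonpos_of_eventually_mul_rpow_le {s c C : ℝ} (hc : 0 < c)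
    (h : ∀ᶠ R : ℝ in atTop, c * R ^ s ≤ C) : s ≤ 0 := by
  by_contra! hs
  obtain ⟨R, h1, h2⟩ := (h.and ((tendsto_rpow_atTop hs).eventually_gt_atTop (C / c))).exists
  rw [div_lt_iff₀' hc] at h2
  linarith

theorem FourierBilinearBound.exists_norm_integral_le {p q a b : ℝ}
    (H : FourierBilinearBound E p q a b) (v w : 𝓢(E, ℂ)) :
    ∃ C : ℝ, 0 ≤ C ∧ ∀ (s t : ℝ) (v' w' : 𝓢(E, ℂ)), 0 ≤ s → 0 ≤ t →
      eLpNorm (𝓕 v' : 𝓢(E, ℂ)) (ENNReal.ofReal p) volume =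
        ENNReal.ofReal s * eLpNorm (𝓕 v : 𝓢(E, ℂ)) (ENNReal.ofReal p) volume →
      eLpNorm (𝓕 w' : 𝓢(E, ℂ)) (ENNReal.ofReal q) volume =
        ENNReal.ofReal t * eLpNorm (𝓕 w : 𝓢(E, ℂ)) (ENNReal.ofReal q) volume →
      ‖∫ ξ, bracketMul a v' ξ * (𝓕 (bracketMul b w') : 𝓢(E, ℂ)) ξ‖ ≤ C * (s * t) := by
  obtain ⟨K, hK, H⟩ := H
  have h1 := ((𝓕 v : 𝓢(E, ℂ)).memLp (ENNReal.ofReal p) volume).2.ne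
  have h2 := ((𝓕 w : 𝓢(E, ℂ)).memLp (ENNReal.ofReal q) volume).2.ne
  refine ⟨K * (eLpNorm (𝓕 v : 𝓢(E, ℂ)) (ENNReal.ofReal p) volume).toReal *
    (eLpNorm (𝓕 w : 𝓢(E, ℂ)) (ENNReal.ofReal q) volume).toReal, by positivity,
    fun s t v' w' hs ht hv hw => ?_⟩
  have := ENNReal.toReal_mono (ENNReal.mul_ne_top (ENNReal.mul_ne_top ENNReal.ofReal_ne_top
    ((𝓕 v' : 𝓢(E, ℂ)).memLp (ENNReal.ofReal p) volume).2.ne)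
    ((𝓕 w' : 𝓢(E, ℂ)).memLp (ENNReal.ofReal q) volume).2.ne) (H v' w')
  rw [toReal_enorm, hv, hw] at this
  simp only [ENNReal.toReal_mul, ENNReal.toReal_ofReal hK, ENNReal.toReal_ofReal hs,
    ENNReal.toReal_ofReal ht] at this
  linarith

/-- A nonzero real-valued smooth bump function supported in the annulus `1 ≤ ‖x‖ ≤ 3`. -/
theorem exists_schwartzMap_annulus [Nontrivial E] :
    ∃ (h : 𝓢(E, ℂ)) (g : E → ℝ), (∀ x, h x = g x) ∧ (∀ x, g x ≠ 0 → 1 ≤ ‖x‖ ∧ ‖x‖ ≤ 3) ∧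
      Integrable (fun x => g x ^ 2) ∧ Integrable (fun x => |g x|) ∧ 0 < ∫ x, g x ^ 2 := by
  obtain ⟨e, he⟩ := exists_norm_eq E (by norm_num : (0 : ℝ) ≤ 2)
  let f : ContDiffBump e := ⟨1 / 2, 1, by norm_num, by norm_num⟩
  have hfs : HasCompactSupport fun x => ((f x : ℝ) : ℂ) :=
    f.hasCompactSupport.comp_left (g := Complex.ofReal) rfl
  have hfd : ContDiff ℝ (⊤ : ℕ∞) fun x => ((f x : ℝ) : ℂ) :=
    Complex.ofRealCLM.contDiff.comp f.contDiff
  have hf2 : HasCompactSupport fun x => f x ^ 2 :=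
    f.hasCompactSupport.comp_left (g := fun y : ℝ => y ^ 2) (by simp)
  have hfc : Continuous f := f.continuous
  refine ⟨hfs.toSchwartzMap hfd, f, fun x => rfl, fun x hx => ?_,
    (hfc.pow 2).integrable_of_hasCompactSupport hf2,
    (hfc.integrable_of_hasCompactSupport f.hasCompactSupport).abs,
    (hfc.pow 2).integral_pos_of_hasCompactSupport_nonneg_nonzero hf2 (fun x => sq_nonneg _)
      (x := e) ?_⟩
  · have hx' : x ∈ Metric.ball e 1 := by
      have : x ∈ Function.support f := hx
      rwa [f.support_eq] at this
    rw [Metric.mem_ball, dist_eq_norm] at hx'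
    have h1 := norm_sub_norm_le x e
    have h2 := norm_sub_norm_le e x
    rw [norm_sub_rev] at h2
    constructor <;> linarith
  · have := f.pos_of_mem_ball (Metric.mem_ball_self f.rOut_pos)
    positivity

theorem fourier_compSubConst_apply (f : 𝓢(E, ℂ)) (η x : E) :
    (𝓕 (f.compSubConstCLM ℂ η) : 𝓢(E, ℂ)) x =
      Real.fourierChar (-⟪η, x⟫) • (𝓕 f : 𝓢(E, ℂ)) x := by
  have := congrFun (VectorFourier.fourierIntegral_comp_add_right Real.fourierChar volume (innerₗ E)
    f (-η)) x
  have e : ((f.compSubConstCLM ℂ η : 𝓢(E, ℂ)) : E → ℂ) = f ∘ fun v => v + -η := by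
    ext v
    simp [sub_eq_add_neg]
  rw [SchwartzMap.fourier_coe, SchwartzMap.fourier_coe, e]
  refine this.trans ?_
  simp only [map_neg, LinearMap.neg_apply, innerₗ_apply_apply]
  rfl

theorem fourierInv_compSubConst_apply (f : 𝓢(E, ℂ)) (η x : E) :
    (𝓕⁻ (f.compSubConstCLM ℂ η) : 𝓢(E, ℂ)) x =
      Real.fourierChar ⟪η, x⟫ • (𝓕⁻ f : 𝓢(E, ℂ)) x := by
  have h : ∀ (g : 𝓢(E, ℂ)) (y : E), (𝓕⁻ g : 𝓢(E, ℂ)) y = (𝓕 g : 𝓢(E, ℂ)) (-y) := fun g y => by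
    rw [SchwartzMap.fourierInv_coe, Real.fourierInv_eq_fourier_neg, SchwartzMap.fourier_coe]
  rw [h, h, fourier_compSubConst_apply, inner_neg_right, neg_neg]

theorem eLpNorm_compSubConst (f : 𝓢(E, ℂ)) (η : E) (p : ℝ≥0∞) :
    eLpNorm (f.compSubConstCLM ℂ η) p volume = eLpNorm f p volume :=
  eLpNorm_comp_measurePreserving f.continuous.aestronglyMeasurable
    (measurePreserving_sub_right volume η)

theorem eLpNorm_fourier_compSubConst (f : 𝓢(E, ℂ)) (η : E) (p : ℝ≥0∞) :
    eLpNorm (𝓕 (f.compSubConstCLM ℂ η) : 𝓢(E, ℂ)) p volume =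
      eLpNorm (𝓕 f : 𝓢(E, ℂ)) p volume := by
  refine eLpNorm_congr_norm_ae (ae_of_all _ fun x => ?_)
  rw [fourier_compSubConst_apply, Circle.norm_smul]

theorem FourierBilinearBound.left_nonpos [Nontrivial E] {p q a b : ℝ}
    (H : FourierBilinearBound E p q a b) : a ≤ 0 := by
  obtain ⟨h, g, hg, hsupp, hint, -, hpos⟩ := exists_schwartzMap_annulus (E := E)
  set w : 𝓢(E, ℂ) := bracketMul (-b) (𝓕⁻ h) with hw
  obtain ⟨C, hC, hle⟩ := H.exists_norm_integral_le h w
  by_contra! ha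
  refine ha.not_ge (nonpos_of_eventually_mul_rpow_le (c := ∫ x, g x ^ 2) (C := C) hpos ?_)
  filter_upwards [eventually_gt_atTop 0] with R hR
  obtain ⟨η, hη⟩ := exists_norm_eq E (by linarith : 0 ≤ R + 3)
  set v' : 𝓢(E, ℂ) := h.compSubConstCLM ℂ η with hv'
  set w' : 𝓢(E, ℂ) := bracketMul (-b) (𝓕⁻ v') with hw'
  have hw'' : w' = 𝓕⁻ ((𝓕 w : 𝓢(E, ℂ)).compSubConstCLM ℂ η) := by
    ext x
    rw [hw', hv', bracketMul_apply, fourierInv_compSubConst_apply, fourierInv_compSubConst_apply,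
      FourierTransform.fourierInv_fourier_eq, hw, bracketMul_apply, mul_smul_comm]
  have hb : bracketMul b w' = 𝓕⁻ v' := by
    simpa using bracketMul_neg_bracketMul (-b) (𝓕⁻ v')
  have key := hle 1 1 v' w' zero_le_one zero_le_one
    (by rw [ENNReal.ofReal_one, one_mul, hv', eLpNorm_fourier_compSubConst])
    (by rw [ENNReal.ofReal_one, one_mul, hw'', FourierTransform.fourier_fourierInv_eq,
      eLpNorm_compSubConst])
  rw [hb, FourierTransform.fourier_fourierInv_eq, mul_one, mul_one] at key
  have e : ∀ ξ, bracketMul a v' ξ * v' ξ =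
      (((1 + ‖ξ‖ ^ 2) ^ (a / 2) * g (ξ - η) ^ 2 : ℝ) : ℂ) := fun ξ => by
    rw [bracketMul_apply, hv', SchwartzMap.compSubConstCLM_apply, hg]
    push_cast
    ring
  have hI : Integrable fun ξ => (1 + ‖ξ‖ ^ 2) ^ (a / 2) * g (ξ - η) ^ 2 := by
    have : Integrable fun ξ => bracketMul a v' ξ * v' ξ := by
      have := (bracketMul a v').memLp 2 volume
      exact this.integrable_mul (v'.memLp 2 volume)
    simp only [e] at this
    simpa only [RCLike.re_to_complex, Complex.ofReal_re] using this.re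
  simp only [e] at key
  rw [integral_complex_ofReal, Complex.norm_real] at key
  refine le_trans ?_ ((le_abs_self _).trans key)
  rw [← integral_sub_right_eq_self _ η, mul_comm, ← integral_const_mul]
  refine integral_mono ((hint.comp_sub_right η).const_mul _) hI fun ξ => ?_
  by_cases h0 : g (ξ - η) = 0
  · simp [h0]
  · refine mul_le_mul_of_nonneg_right ?_ (sq_nonneg _)
    have h1 := (hsupp _ h0).2
    have h2 := norm_sub_norm_le η ξ
    rw [norm_sub_rev] at h2
    have h3 : R ^ 2 ≤ 1 + ‖ξ‖ ^ 2 := by nlinarith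
    calc R ^ a = (R ^ 2) ^ (a / 2) := by
          rw [← Real.rpow_natCast, ← Real.rpow_mul hR.le]
          congr 1
          push_cast
          ring
      _ ≤ _ := Real.rpow_le_rpow (by positivity) h3 (by linarith)

theorem fourier_dilate_apply (c : ℝˣ) (f : 𝓢(E, ℂ)) (x : E) :
    (𝓕 (dilate c f) : 𝓢(E, ℂ)) x = |((c : ℝ) ^ Module.finrank ℝ E)⁻¹| •
      (𝓕 f : 𝓢(E, ℂ)) (((c⁻¹ : ℝˣ) : ℝ) • x) := by
  rw [SchwartzMap.fourier_coe, SchwartzMap.fourier_coe, Real.fourier_eq, Real.fourier_eq,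
    ← Measure.integral_comp_smul]
  refine integral_congr_ae (ae_of_all _ fun v => ?_)
  simp only [dilate_apply]
  rw [inner_smul_left, inner_smul_right, ← mul_assoc]
  simp

theorem eLpNorm_dilate (c : ℝˣ) (hc : 0 < (c : ℝ)) (f : 𝓢(E, ℂ)) {p : ℝ} (hp : 0 < p) :
    eLpNorm (dilate c f) (ENNReal.ofReal p) volume =
      ENNReal.ofReal ((c : ℝ) ^ (-(Module.finrank ℝ E / p))) *
        eLpNorm f (ENNReal.ofReal p) volume := by
  have hf : AEStronglyMeasurable f (Measure.map (fun x : E => (c : ℝ) • x) volume) :=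
    f.continuous.aestronglyMeasurable
  have h := eLpNorm_map_measure (p := ENNReal.ofReal p) hf (by fun_prop)
  rw [Measure.map_addHaar_smul _ hc.ne', eLpNorm_smul_measure_of_ne_top ENNReal.ofReal_ne_top] at h
  refine h.symm.trans ?_
  rw [smul_eq_mul, one_div, ENNReal.toReal_inv, ENNReal.toReal_ofReal hp.le,
    ENNReal.ofReal_rpow_of_nonneg (by positivity) (by positivity), abs_of_pos (by positivity),
    ← Real.rpow_natCast, ← Real.rpow_neg hc.le, ← Real.rpow_mul hc.le, neg_mul, div_eq_mul_inv]

theorem eLpNorm_fourier_dilate (c : ℝˣ) (hc : 0 < (c : ℝ)) (f : 𝓢(E, ℂ)) {p : ℝ} (hp : 0 < p) :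
    eLpNorm (𝓕 (dilate c f) : 𝓢(E, ℂ)) (ENNReal.ofReal p) volume =
      ENNReal.ofReal ((c : ℝ) ^ (Module.finrank ℝ E / p - Module.finrank ℝ E)) *
        eLpNorm (𝓕 f : 𝓢(E, ℂ)) (ENNReal.ofReal p) volume := by
  have e : ((𝓕 (dilate c f) : 𝓢(E, ℂ)) : E → ℂ) =
      |((c : ℝ) ^ Module.finrank ℝ E)⁻¹| • (dilate c⁻¹ (𝓕 f) : E → ℂ) := by
    ext x
    rw [fourier_dilate_apply]
    rfl
  have hc' : 0 < ((c⁻¹ : ℝˣ) : ℝ) := by simpa using hc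
  rw [e, eLpNorm_const_smul, eLpNorm_dilate _ hc' _ hp, ← mul_assoc, Real.enorm_eq_ofReal_abs,
    abs_abs, ← ENNReal.ofReal_mul (abs_nonneg _), abs_of_pos (by positivity),
    Units.val_inv_eq_inv_val, Real.inv_rpow hc.le, ← Real.rpow_neg hc.le, neg_neg,
    ← Real.rpow_natCast, ← Real.rpow_neg hc.le, ← Real.rpow_add hc, neg_add_eq_sub]

theorem tendsto_integral_norm_bracket_smul_sub {b : ℝ} (hb : b ≤ 0) (u : 𝓢(E, ℂ)) :
    Tendsto (fun R : ℝ => ∫ x, ‖(((1 + ‖R⁻¹ • x‖ ^ 2) ^ (b / 2) : ℝ) : ℂ) * u x - u x‖)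
      atTop (nhds 0) := by
  rw [← integral_zero E ℝ (μ := volume)]
  refine tendsto_integral_filter_of_dominated_convergence (fun x => ‖u x‖)
    (Eventually.of_forall fun R => Measurable.aestronglyMeasurable (by fun_prop))
    (Eventually.of_forall fun R => ae_of_all _ fun x => ?_) u.integrable.norm
    (ae_of_all _ fun x => ?_)
  · have h1 : (1 + ‖R⁻¹ • x‖ ^ 2) ^ (b / 2) ≤ 1 :=
      Real.rpow_le_one_of_one_le_of_nonpos (by nlinarith [sq_nonneg ‖R⁻¹ • x‖]) (by linarith)
    have h0 : 0 ≤ (1 + ‖R⁻¹ • x‖ ^ 2) ^ (b / 2) := by positivity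
    rw [norm_norm, ← sub_one_mul, norm_mul, ← Complex.ofReal_one, ← Complex.ofReal_sub,
      Complex.norm_real, Real.norm_eq_abs]
    refine mul_le_of_le_one_left (norm_nonneg _) (abs_le.2 ⟨by linarith, by linarith⟩)
  · have h1 : Tendsto (fun R : ℝ => (1 + ‖R⁻¹ • x‖ ^ 2) ^ (b / 2)) atTop
        (nhds ((1 + ‖(0 : ℝ) • x‖ ^ 2) ^ (b / 2))) :=
      Tendsto.rpow_const (((tendsto_inv_atTop_zero.smul_const x).norm.pow 2).const_add 1)
        (Or.inl (by positivity))
    have h2 := (((Complex.continuous_ofReal.tendsto _).comp h1).mul_const (u x)).sub_const (u x)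
    simpa using h2.norm

theorem FourierBilinearBound.left_le [Nontrivial E] {p q a b : ℝ} (hpq : p.HolderConjugate q)
    (H : FourierBilinearBound E p q a b) (hb : b ≤ 0) :
    a ≤ -(Module.finrank ℝ E * (2 / p - 1)) := by
  have ha := H.left_nonpos
  set d : ℝ := (Module.finrank ℝ E : ℝ) with hd
  obtain ⟨h, g, hg, hsupp, hint, hint1, hpos⟩ := exists_schwartzMap_annulus (E := E)
  set u : 𝓢(E, ℂ) := 𝓕⁻ h with hu
  obtain ⟨C, hC, hle⟩ := H.exists_norm_integral_le h u
  set J := ∫ x, g x ^ 2 with hJ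
  set N := ∫ x, |g x| with hN
  set δ : ℝ → ℝ := fun R => ∫ x, ‖(((1 + ‖R⁻¹ • x‖ ^ 2) ^ (b / 2) : ℝ) : ℂ) * u x - u x‖ with hδ
  have hδlim : Tendsto (fun R => δ R * N) atTop (nhds 0) := by
    simpa using (tendsto_integral_norm_bracket_smul_sub hb u).mul_const N
  have hc : 0 < (10 : ℝ) ^ (a / 2) * J / 2 := by positivity
  have hmain : a + (d / p - d / q) ≤ 0 := by
    refine nonpos_of_eventually_mul_rpow_le (C := C) hc ?_
    filter_upwards [eventually_ge_atTop 1, hδlim.eventually_le_const hc] with R hR1 hδR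
    have hR : 0 < R := by linarith
    set c : ℝˣ := Units.mk0 R hR.ne' with hcdef
    have hcR : (c : ℝ) = R := rfl
    have hcR' : ((c⁻¹ : ℝˣ) : ℝ) = R⁻¹ := rfl
    set G : 𝓢(E, ℂ) := dilate c⁻¹ (bracketMul b (dilate c u)) with hG
    have hGx : ∀ x, G x = (((1 + ‖R⁻¹ • x‖ ^ 2) ^ (b / 2) : ℝ) : ℂ) * u x := fun x => by
      rw [hG, dilate_apply, bracketMul_apply, dilate_apply, smul_smul, hcR', hcR,
        mul_inv_cancel₀ hR.ne', one_smul]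
    have hGf : ∀ y, ‖(𝓕 G : 𝓢(E, ℂ)) y - h y‖ ≤ δ R := fun y => by
      have e : (𝓕 G : 𝓢(E, ℂ)) y - h y = 𝓕 ((G - u : 𝓢(E, ℂ)) : E → ℂ) y := by
        rw [← SchwartzMap.fourier_coe, sub_eq_add_neg G u, FourierTransform.fourier_add,
          FourierTransform.fourier_neg, ← sub_eq_add_neg, hu,
          FourierTransform.fourier_fourierInv_eq]
        rfl
      rw [e]
      refine (VectorFourier.norm_fourierIntegral_le_integral_norm _ _ _ _ _).trans_eq ?_
      simp only [sub_apply, hGx, hδ]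
    set β : E → ℝ := fun y => (1 + ‖R • y‖ ^ 2) ^ (a / 2) with hβ
    have hval : ∫ ξ, bracketMul a (dilate c⁻¹ h) ξ *
        (𝓕 (bracketMul b (dilate c u)) : 𝓢(E, ℂ)) ξ =
        ∫ y, (β y : ℂ) * h y * (𝓕 G : 𝓢(E, ℂ)) y := by
      have e1 : bracketMul b (dilate c u) = dilate c G := (dilate_dilate_inv c _).symm
      have hRd : 0 < R ^ Module.finrank ℝ E := by positivity
      have e2 := Measure.integral_comp_smul (volume : Measure E)
        (fun y => (β y : ℂ) * h y * (𝓕 G : 𝓢(E, ℂ)) y) R⁻¹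
      rw [inv_pow, inv_inv, abs_of_pos hRd] at e2
      calc _ = ∫ ξ, (R ^ Module.finrank ℝ E)⁻¹ • ((β (R⁻¹ • ξ) : ℂ) * h (R⁻¹ • ξ) *
            (𝓕 G : 𝓢(E, ℂ)) (R⁻¹ • ξ)) := by
            refine integral_congr_ae (ae_of_all _ fun ξ => ?_)
            simp only
            rw [e1, fourier_dilate_apply, bracketMul_apply, dilate_apply, hcR, hcR',
              abs_of_pos (by positivity), mul_smul_comm, hβ]
            simp only
            rw [smul_smul, mul_inv_cancel₀ hR.ne', one_smul]
        _ = _ := by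
            rw [integral_smul, e2, smul_smul, inv_mul_cancel₀ hRd.ne', one_smul]
    have hβle : ∀ y, g y ≠ 0 → β y ≤ R ^ a := fun y hy => by
      have h1 := (hsupp y hy).1
      rw [hβ]
      simp only [norm_smul, Real.norm_eq_abs, abs_of_pos hR]
      calc _ ≤ (R ^ 2) ^ (a / 2) := Real.rpow_le_rpow_of_nonpos (by positivity)
            (by nlinarith [mul_le_mul_of_nonneg_left h1 hR.le]) (by linarith)
        _ = R ^ a := by
          rw [← Real.rpow_natCast, ← Real.rpow_mul hR.le]; congr 1; push_cast; ring
    have hβge : ∀ y, g y ≠ 0 → (10 : ℝ) ^ (a / 2) * R ^ a ≤ β y := fun y hy => by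
      have h1 := (hsupp y hy).2
      rw [hβ]
      simp only [norm_smul, Real.norm_eq_abs, abs_of_pos hR]
      calc _ = (10 * R ^ 2) ^ (a / 2) := by
            rw [Real.mul_rpow (by positivity) (by positivity), ← Real.rpow_natCast R,
              ← Real.rpow_mul hR.le]
            congr 2
            push_cast
            ring
        _ ≤ _ := Real.rpow_le_rpow_of_nonpos (by positivity) (by
            have h3 : R * ‖y‖ ≤ 3 * R := by nlinarith
            have : 0 ≤ R * ‖y‖ := by positivity
            nlinarith) (by linarith)
    have hβ0 : ∀ y, 0 ≤ β y := fun y => by positivity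
    have hβh : ∀ v : 𝓢(E, ℂ), Integrable fun y => (β y : ℂ) * h y * v y := fun v => by
      have := (dilate c (bracketMul a (dilate c⁻¹ h))).memLp 2 volume
      refine (this.integrable_mul (v.memLp 2 volume)).congr (ae_of_all _ fun y => ?_)
      rw [Pi.mul_apply, dilate_apply, bracketMul_apply, dilate_apply, smul_smul, hcR', hcR,
        inv_mul_cancel₀ hR.ne', one_smul]
    have hsplit : ∫ y, (β y : ℂ) * h y * (𝓕 G : 𝓢(E, ℂ)) y =
        ((∫ y, β y * g y ^ 2 : ℝ) : ℂ) + ∫ y, (β y : ℂ) * h y * (𝓕 G - h : 𝓢(E, ℂ)) y := by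
      rw [← integral_complex_ofReal, ← integral_add ?_ (hβh _)]
      · refine integral_congr_ae (ae_of_all _ fun y => ?_)
        simp only [sub_apply, hg]
        push_cast
        ring
      · refine (hβh h).congr (ae_of_all _ fun y => ?_)
        simp only [hg]
        push_cast
        ring
    have hI1 : Integrable fun y => β y * g y ^ 2 := by
      have := (hβh h).re
      refine this.congr (ae_of_all _ fun y => ?_)
      simp only [hg, RCLike.re_to_complex]
      rw [← Complex.ofReal_mul, ← Complex.ofReal_mul, Complex.ofReal_re]
      ring
    have hlow : (10 : ℝ) ^ (a / 2) * R ^ a * J ≤ ∫ y, β y * g y ^ 2 := by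
      rw [hJ, ← integral_const_mul]
      refine integral_mono (hint.const_mul _) hI1 fun y => ?_
      by_cases h0 : g y = 0
      · simp [h0]
      · exact mul_le_mul_of_nonneg_right (hβge y h0) (sq_nonneg _)
    have herr : ‖∫ y, (β y : ℂ) * h y * (𝓕 G - h : 𝓢(E, ℂ)) y‖ ≤ R ^ a * (δ R * N) := by
      have : R ^ a * (δ R * N) = ∫ y, R ^ a * δ R * |g y| := by
        rw [integral_const_mul, mul_assoc]
      rw [this]
      refine norm_integral_le_of_norm_le (hint1.const_mul _) (ae_of_all _ fun y => ?_)
      rw [norm_mul, norm_mul, Complex.norm_real, Real.norm_of_nonneg (hβ0 y), hg,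
        Complex.norm_real, Real.norm_eq_abs, sub_apply]
      by_cases h0 : g y = 0
      · simp [h0]
      · rw [mul_right_comm]
        have := hGf y
        rw [hg] at this ⊢
        gcongr
        exact hβle y h0
    have key := hle (R ^ (d - d / p)) (R ^ (d / q - d)) (dilate c⁻¹ h) (dilate c u) (by positivity)
      (by positivity)
      (by
        rw [eLpNorm_fourier_dilate _ (by rw [hcR']; positivity) _ hpq.pos, hcR',
          Real.inv_rpow hR.le, ← Real.rpow_neg hR.le, neg_sub])
      (by rw [eLpNorm_fourier_dilate _ hR _ hpq.symm.pos, hcR])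
    rw [hval, hsplit, ← Real.rpow_add hR] at key
    have hn := norm_sub_le_norm_add ((∫ y, β y * g y ^ 2 : ℝ) : ℂ)
      (∫ y, (β y : ℂ) * h y * (𝓕 G - h : 𝓢(E, ℂ)) y)
    have habs := le_abs_self (∫ y, β y * g y ^ 2)
    rw [Complex.norm_real, Real.norm_eq_abs] at hn
    have hRa : 0 < R ^ a := by positivity
    have h1 : (10 : ℝ) ^ (a / 2) * J / 2 * R ^ a ≤ C * R ^ (d - d / p + (d / q - d)) := by
      nlinarith [mul_le_mul_of_nonneg_left hδR hRa.le]
    have h2 : R ^ (d - d / p + (d / q - d)) * R ^ (d / p - d / q) = 1 := by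
      rw [← Real.rpow_add hR]
      ring_nf
      exact Real.rpow_zero R
    calc _ = (10 : ℝ) ^ (a / 2) * J / 2 * R ^ a * R ^ (d / p - d / q) := by
          rw [Real.rpow_add hR, mul_assoc _ (R ^ a)]
      _ ≤ C * R ^ (d - d / p + (d / q - d)) * R ^ (d / p - d / q) := by gcongr
      _ = C := by rw [mul_assoc, h2, mul_one]
  have e : d / q = d - d / p := by
    rw [div_eq_mul_inv, div_eq_mul_inv, ← hpq.symm.one_sub_inv]
    ring
  have e2 : d * (2 / p - 1) = 2 * (d / p) - d := by ring
  linarith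

end

theorem FT_coe {d : ℕ} (f : 𝓢(EuclideanSpace ℝ (Fin d), ℂ)) :
    FT f = (𝓕 f : 𝓢(EuclideanSpace ℝ (Fin d), ℂ)) := by
  ext ξ
  rw [SchwartzMap.fourier_coe, Real.fourier_eq, FT]
  refine integral_congr_ae (ae_of_all _ fun x => ?_)
  simp only [Circle.smul_def, Real.fourierChar_apply, real_inner_comm ξ x, smul_eq_mul]
  congr 2
  push_cast
  ring

theorem IFT_coe {d : ℕ} (h : 𝓢(EuclideanSpace ℝ (Fin d), ℂ)) :
    IFT h = (𝓕⁻ h : 𝓢(EuclideanSpace ℝ (Fin d), ℂ)) := by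
  ext x
  rw [SchwartzMap.fourierInv_coe, Real.fourierInv_eq, IFT]
  refine integral_congr_ae (ae_of_all _ fun ξ => ?_)
  simp only [Circle.smul_def, Real.fourierChar_apply, real_inner_comm x ξ, smul_eq_mul]

theorem sobolevNorm_coe {d : ℕ} (p k : ℝ) (f : 𝓢(EuclideanSpace ℝ (Fin d), ℂ)) :
    sobolevNorm p k f = eLpNorm (𝓕⁻ (bracketMul k (𝓕 f)) : 𝓢(EuclideanSpace ℝ (Fin d), ℂ))
      (ENNReal.ofReal p) volume := by
  rw [← IFT_coe, sobolevNorm, FT_coe]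
  congr 2
  ext ξ
  rw [bracketMul_apply]

theorem exists_sobolevNorm_FT_le_iff {d : ℕ} {p q k₁ k₂ : ℝ} (hpq : p.HolderConjugate q) :
    (∃ C : ℝ, 0 < C ∧ ∀ f : 𝓢(EuclideanSpace ℝ (Fin d), ℂ),
        sobolevNorm p k₂ (FT fun x => f x) ≤ ENNReal.ofReal C * sobolevNorm p k₁ fun x => f x) ↔
      FourierBilinearBound (EuclideanSpace ℝ (Fin d)) p q (-k₁) k₂ := by
  rw [fourierBilinearBound_iff hpq]
  simp only [FT_coe, sobolevNorm_coe]
  constructor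
  · rintro ⟨C, hC, h⟩
    exact ⟨C, hC.le, h⟩
  · rintro ⟨K, hK, h⟩
    refine ⟨K + 1, by positivity, fun f => (h f).trans ?_⟩
    gcongr
    linarith

/-- **Sharpness of the `L^p` estimates for time-slicing approximations**
(Nicola, Prop. 7.1 in [Convergence in `L^p` for Feynman path integrals]): for
`1 < p < ∞` and `k₁, k₂ ∈ ℝ`, the Fourier transform is bounded
`L^p_{k₁}(ℝ^d) → L^p_{k₂}(ℝ^d)` if and only if
`k₁ ≥ 2d(1/p - 1/2)` and `k₂ ≤ 0` (when `p ≤ 2`), or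
`k₁ ≥ 0` and `k₂ ≤ -2d(1/2 - 1/p)` (when `p ≥ 2`). -/
theorem fourier_sobolev_bounded_iff
    {d : ℕ} (hd : 1 ≤ d) (p k₁ k₂ : ℝ) (hp : 1 < p) :
    (∃ C : ℝ, 0 < C ∧ ∀ f : SchwartzMap (EuclideanSpace ℝ (Fin d)) ℂ,
        sobolevNorm p k₂ (FT fun x => f x) ≤ ENNReal.ofReal C * sobolevNorm p k₁ fun x => f x) ↔
      ((p ≤ 2 ∧ 2 * d * (1 / p - 1 / 2) ≤ k₁ ∧ k₂ ≤ 0) ∨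
        (2 ≤ p ∧ 0 ≤ k₁ ∧ k₂ ≤ -(2 * d * (1 / 2 - 1 / p)))) := by
  set E := EuclideanSpace ℝ (Fin d)
  have hpq : p.HolderConjugate (p / (p - 1)) := Real.HolderConjugate.conjExponent hp
  set q := p / (p - 1) with hq
  have hdim : Module.finrank ℝ E = d := finrank_euclideanSpace_fin
  have hdim0 : 0 < Module.finrank ℝ E := by omega
  have : Nontrivial E := Module.nontrivial_of_finrank_pos hdim0
  have hq2 : 2 / q - 1 = -(2 / p - 1) := by
    rw [div_eq_mul_inv, div_eq_mul_inv, ← hpq.one_sub_inv]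
    ring
  have h1 : 2 * (d : ℝ) * (1 / p - 1 / 2) = d * (2 / p - 1) := by ring
  have h2 : -(2 * (d : ℝ) * (1 / 2 - 1 / p)) = d * (2 / p - 1) := by ring
  rw [exists_sobolevNorm_FT_le_iff hpq, h1, h2]
  constructor
  · intro H
    have ha := H.left_nonpos
    have hb := H.symm.left_nonpos
    have ha' := H.left_le hpq hb
    have hb' := H.symm.left_le hpq.symm ha
    rw [hdim] at ha' hb'
    rw [hq2] at hb'
    rcases le_total p 2 with h | h
    · exact Or.inl ⟨h, by linarith, hb⟩
    · exact Or.inr ⟨h, by linarith, by linarith⟩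
  · rintro (⟨h, ha, hb⟩ | ⟨h, ha, hb⟩)
    · exact fourierBilinearBound_of_le_two hdim0 hpq h (by rw [hdim]; linarith) hb
    · have hq' : q ≤ 2 := by
        rw [hq, div_le_iff₀ (by linarith)]
        linarith
      refine (fourierBilinearBound_of_le_two hdim0 hpq.symm hq' ?_ (by linarith)).symm
      rw [hdim, hq2]
      linarith
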